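/- Let R ∈ ℝ^{n×n} be row-stochastic, π ∈ ℝⁿ with πᵀ R = πᵀ and πᵀ 𝟙 = 1, and Π := 𝟙 πᵀ. Let S ∈ ℝ^{n×n} be invertible, ρ ∈ (0,1), and κ ≥ 0 be such that ‖S(R X − Π X)‖_F ≤ ρ ‖S(X − Π X)‖_F and ‖S(R − Π) Y‖_F ≤ κ ‖S Y‖_F for all X, Y ∈ ℝ^{n×d}. Then for any X, V ∈ ℝ^{n×d} and any step size η ∈ ℝ, setting X⁺ := R(X − η V), one has ‖S(X⁺ − Π X⁺)‖_F² ≤ ((1 + ρ²)/2) ‖S(X − Π X)‖_F² + η² κ² ((1 + ρ²)/(1 − ρ²)) ‖S V‖_F². -/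

import Mathlib

open Matrix BigOperators

/-- The stationary projection `Π = 𝟙 πᵀ` associated with a row-stochastic matrix. -/
noncomputable def projR {n : ℕ} (π : Fin n → ℝ) : Matrix (Fin n) (Fin n) ℝ :=
  Matrix.vecMulVec (fun _ => (1 : ℝ)) π

/-- Frobenius norm of an `n × d` real matrix. -/
noncomputable def frobNorm {n d : ℕ} (X : Matrix (Fin n) (Fin d) ℝ) : ℝ :=
  Real.sqrt (∑ i, ∑ j, (X i j) ^ 2)

lemma frobNorm_sq_aux {n d : ℕ} (X : Matrix (Fin n) (Fin d) ℝ) :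
    frobNorm X ^ 2 = ∑ i, ∑ j, (X i j) ^ 2 := by
  unfold frobNorm
  exact Real.sq_sqrt (Finset.sum_nonneg fun i _ => Finset.sum_nonneg fun j _ => sq_nonneg _)

lemma frobNorm_nonneg_aux {n d : ℕ} (X : Matrix (Fin n) (Fin d) ℝ) : 0 ≤ frobNorm X :=
  Real.sqrt_nonneg _

lemma young_aux (ρ a b : ℝ) (h0 : 0 < ρ) (h1 : ρ < 1) :
    (a - b) ^ 2 ≤ (1 + ρ ^ 2) / (2 * ρ ^ 2) * a ^ 2 + (1 + ρ ^ 2) / (1 - ρ ^ 2) * b ^ 2 := by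
  have h2 : 0 < 1 - ρ ^ 2 := by nlinarith
  have h3 : (1 + ρ ^ 2) / (2 * ρ ^ 2) * a ^ 2 + (1 + ρ ^ 2) / (1 - ρ ^ 2) * b ^ 2 - (a - b) ^ 2
      = ((1 - ρ ^ 2) * a + 2 * ρ ^ 2 * b) ^ 2 / (2 * ρ ^ 2 * (1 - ρ ^ 2)) := by
    field_simp
    ring
  have h4 : 0 ≤ ((1 - ρ ^ 2) * a + 2 * ρ ^ 2 * b) ^ 2 / (2 * ρ ^ 2 * (1 - ρ ^ 2)) := by
    positivity
  linarith

/-- **One-step consensus error bound.**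
Let `R` be row-stochastic with `πᵀ R = πᵀ`, `πᵀ 𝟙 = 1`, `Π := 𝟙 πᵀ`; let `S` be invertible,
`ρ ∈ (0,1)`, `κ ≥ 0` with `‖S (R X − Π X)‖_F ≤ ρ ‖S (X − Π X)‖_F` and
`‖S (R − Π) Y‖_F ≤ κ ‖S Y‖_F` for all `X, Y`. Then, with `X⁺ := R (X − η V)`,
`‖S (X⁺ − Π X⁺)‖_F² ≤ (1+ρ²)/2 ‖S (X − Π X)‖_F² + η² κ² (1+ρ²)/(1−ρ²) ‖S V‖_F²`. -/
theorem consensus_error_one_step {n d : ℕ} (R : Matrix (Fin n) (Fin n) ℝ)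
    (hR_nonneg : ∀ i j, 0 ≤ R i j) (hR_row : ∀ i, ∑ j, R i j = 1)
    (π : Fin n → ℝ) (hπ_stat : Matrix.vecMul π R = π) (hπ_sum : ∑ i, π i = 1)
    (S : Matrix (Fin n) (Fin n) ℝ) (hS : IsUnit S)
    (ρ κ : ℝ) (hρ : ρ ∈ Set.Ioo (0 : ℝ) 1) (hκ : 0 ≤ κ)
    (hcontract : ∀ X : Matrix (Fin n) (Fin d) ℝ,
      frobNorm (S * (R * X - projR π * X)) ≤ ρ * frobNorm (S * (X - projR π * X)))
    (hbound : ∀ Y : Matrix (Fin n) (Fin d) ℝ,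
      frobNorm (S * ((R - projR π) * Y)) ≤ κ * frobNorm (S * Y))
    (X V : Matrix (Fin n) (Fin d) ℝ) (η : ℝ) :
    frobNorm (S * (R * (X - η • V) - projR π * (R * (X - η • V)))) ^ 2 ≤
      (1 + ρ ^ 2) / 2 * frobNorm (S * (X - projR π * X)) ^ 2
        + η ^ 2 * κ ^ 2 * ((1 + ρ ^ 2) / (1 - ρ ^ 2)) * frobNorm (S * V) ^ 2 := by
  obtain ⟨h0, h1⟩ := hρ
  have h2 : 0 < 1 - ρ ^ 2 := by nlinarith
  have hPR : projR π * R = projR π := by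
    unfold projR
    rw [Matrix.vecMulVec_mul, hπ_stat]
  have hdec : S * (R * (X - η • V) - projR π * (R * (X - η • V)))
      = S * (R * X - projR π * X) - η • (S * ((R - projR π) * V)) := by
    rw [← Matrix.mul_assoc (projR π), hPR]
    simp only [Matrix.mul_sub, Matrix.sub_mul, Matrix.mul_smul, smul_sub]
    abel
  rw [hdec]
  have hA := pow_le_pow_left₀ (frobNorm_nonneg_aux _) (hcontract X) 2
  have hB := pow_le_pow_left₀ (frobNorm_nonneg_aux _) (hbound V) 2
  generalize S * (R * X - projR π * X) = A at *
  generalize S * ((R - projR π) * V) = B at *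
  have key : frobNorm (A - η • B) ^ 2 ≤ (1 + ρ ^ 2) / (2 * ρ ^ 2) * frobNorm A ^ 2
      + (1 + ρ ^ 2) / (1 - ρ ^ 2) * (η ^ 2 * frobNorm B ^ 2) := by
    simp only [frobNorm_sq_aux, Finset.mul_sum, ← Finset.sum_add_distrib]
    refine Finset.sum_le_sum fun i _ => Finset.sum_le_sum fun j _ => ?_
    have := young_aux ρ (A i j) (η * B i j) h0 h1
    simpa [mul_pow] using this
  refine key.trans ?_
  calc _ ≤ (1 + ρ ^ 2) / (2 * ρ ^ 2) * (ρ * frobNorm (S * (X - projR π * X))) ^ 2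
      + (1 + ρ ^ 2) / (1 - ρ ^ 2) * (η ^ 2 * (κ * frobNorm (S * V)) ^ 2) := by gcongr
    _ = _ := by
      field_simp
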